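/- Every simple planar cycle-extendable graph with minimum degree at least three is a brick. -/

import Mathlib

open SimpleGraph

variable {V : Type*}

/-- A matching covered graph: a connected graph with at least two vertices in which
every edge belongs to some perfect matching. -/
def MatchingCovered (G : SimpleGraph V) : Prop :=
  G.Connected ∧ Nontrivial V ∧
    ∀ e ∈ G.edgeSet, ∃ M : G.Subgraph, M.IsPerfectMatching ∧ e ∈ M.edgeSet

/-- A cycle `C` is conformal if `G - V(C)` has a perfect matching. -/
def ConformalCycle (G : SimpleGraph V) {u : V} (C : G.Walk u u) : Prop :=
  ∃ M : G.Subgraph, M.IsMatching ∧ M.verts = {w | w ∉ C.support}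

/-- A matching covered graph is cycle-extendable if each of its even cycles is conformal. -/
def CycleExtendable (G : SimpleGraph V) : Prop :=
  ∀ ⦃u : V⦄ (C : G.Walk u u), C.IsCycle → Even C.length → ConformalCycle G C
/-- `X` determines a tight cut of `G`: `X` is a nonempty proper set of vertices and
every perfect matching of `G` has exactly one edge with one end in `X` and one end
outside `X`. -/
def IsTightCut (G : SimpleGraph V) (X : Set V) : Prop :=
  X.Nonempty ∧ X ≠ Set.univ ∧
    ∀ M : G.Subgraph, M.IsPerfectMatching →
      ∃! p : V × V, p.1 ∈ X ∧ p.2 ∉ X ∧ M.Adj p.1 p.2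

/-- `G` has a nontrivial tight cut: a tight cut both of whose shores have
at least two vertices. -/
def HasNontrivialTightCut (G : SimpleGraph V) : Prop :=
  ∃ X : Set V, IsTightCut G X ∧ 2 ≤ X.ncard ∧ 2 ≤ Xᶜ.ncard

/-- A brick: a nonbipartite matching covered graph with no nontrivial tight cut. -/
def IsBrick (G : SimpleGraph V) : Prop :=
  MatchingCovered G ∧ ¬ G.Colorable 2 ∧ ¬ HasNontrivialTightCut G

/-- A brace: a bipartite matching covered graph with no nontrivial tight cut. -/
def IsBrace (G : SimpleGraph V) : Prop :=
  MatchingCovered G ∧ G.Colorable 2 ∧ ¬ HasNontrivialTightCut G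
/-- `G` contains a subgraph which is a subdivision of `K` in which the path replacing
each edge has length satisfying `okLen`: there are internally disjoint paths in `G`
joining the images of the branch vertices. -/
def HasSubdiv {W : Type*} (G : SimpleGraph V) (K : SimpleGraph W) (okLen : ℕ → Prop) : Prop :=
  ∃ (f : W ↪ V) (p : ∀ a b : W, K.Adj a b → G.Walk (f a) (f b)),
    (∀ a b hab, (p a b hab).IsPath) ∧
    (∀ a b hab, okLen (p a b hab).length) ∧
    (∀ a b hab (c : W), f c ∈ (p a b hab).support → c = a ∨ c = b) ∧
    (∀ a b hab a' b' hab', s(a, b) ≠ s(a', b') →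
      ∀ w, w ∈ (p a b hab).support → w ∈ (p a' b' hab').support →
        (w = f a ∨ w = f b) ∧ (w = f a' ∨ w = f b'))

/-- `G` is `K`-based: some subgraph of `G` is a bisubdivision of `K` (each edge of `K`
is replaced by an odd path, i.e. subdivided by an even number of vertices). -/
def IsBasedOn {W : Type*} (G : SimpleGraph V) (K : SimpleGraph W) : Prop :=
  HasSubdiv G K Odd

/-- `G` contains a subdivision of `K`. -/
def ContainsSubdivision {W : Type*} (G : SimpleGraph V) (K : SimpleGraph W) : Prop :=
  HasSubdiv G K fun _ => True

/-- Planarity, via Kuratowski's characterization: no subdivision of `K₅` nor of `K₃,₃`. -/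
def IsPlanar (G : SimpleGraph V) : Prop :=
  ¬ ContainsSubdivision G (⊤ : SimpleGraph (Fin 5)) ∧
  ¬ ContainsSubdivision G (completeBipartiteGraph (Fin 3) (Fin 3))

/-- `G` is `K₂,₃`-based: it contains a subgraph that is a bisubdivision of `K₂,₃`. -/
def K23Based (G : SimpleGraph V) : Prop :=
  IsBasedOn G (completeBipartiteGraph (Fin 2) (Fin 3))

/-- The concatenation of two paths meeting only at their common end is a path. -/
lemma isPath_append_of_inter {G : SimpleGraph V} {u v w : V} {p : G.Walk u v} {q : G.Walk v w}
    (hp : p.IsPath) (hq : q.IsPath) (h : ∀ x ∈ p.support, x ∈ q.support → x = v) :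
    (p.append q).IsPath := by
  induction p with
  | nil => simpa using hq
  | @cons a b c hab p ih =>
    rw [Walk.cons_isPath_iff] at hp
    rw [Walk.cons_append, Walk.cons_isPath_iff]
    refine ⟨ih hp.1 hq fun x hx => h x (by simp [hx]), fun ha => ?_⟩
    rw [Walk.mem_support_append_iff] at ha
    refine ha.elim hp.2 fun ha => ?_
    have hac := h a (by simp) ha
    exact hp.2 (hac ▸ p.end_mem_support)

/-- There is a path of length `n` from `u` to `v` in `G` all of whose vertices lie in `S`. -/
def PathIn (G : SimpleGraph V) (S : Set V) (n : ℕ) (u v : V) : Prop :=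
  ∃ p : G.Walk u v, p.IsPath ∧ p.length = n ∧ ∀ w ∈ p.support, w ∈ S

namespace PathIn

variable {G : SimpleGraph V} {S T : Set V} {m n : ℕ} {u v w : V}

lemma mono (h : PathIn G S n u v) (hST : S ⊆ T) : PathIn G T n u v := by
  obtain ⟨p, hp, hn, hS⟩ := h
  exact ⟨p, hp, hn, fun w hw => hST (hS w hw)⟩

lemma refl (h : u ∈ S) : PathIn G S 0 u u :=
  ⟨.nil, by simp, by simp, by simpa using h⟩

lemma symm (h : PathIn G S n u v) : PathIn G S n v u := by
  obtain ⟨p, hp, hn, hS⟩ := h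
  exact ⟨p.reverse, hp.reverse, by simpa using hn, by simpa using hS⟩

lemma left_mem (h : PathIn G S n u v) : u ∈ S := by
  obtain ⟨p, -, -, hS⟩ := h
  exact hS _ p.start_mem_support

lemma right_mem (h : PathIn G S n u v) : v ∈ S := h.symm.left_mem

lemma of_adj (h : G.Adj u v) : PathIn G {u, v} 1 u v :=
  ⟨.cons h .nil, by simp [h.ne], by simp, by simp⟩

lemma append (h : PathIn G S m u v) (h' : PathIn G T n v w) (hST : S ∩ T ⊆ {v}) :
    PathIn G (S ∪ T) (m + n) u w := by
  obtain ⟨p, hp, hm, hS⟩ := h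
  obtain ⟨q, hq, hn, hT⟩ := h'
  refine ⟨p.append q, ?_, by simp [hm, hn], ?_⟩
  · exact isPath_append_of_inter hp hq fun x hx hx' => hST ⟨hS x hx, hT x hx'⟩
  · intro x hx
    rw [Walk.mem_support_append_iff] at hx
    exact hx.imp (hS x) (hT x)

lemma trans (h : PathIn G S m u v) (h' : PathIn G S n v w) : ∃ k, PathIn G S k u w := by
  classical
  obtain ⟨p, -, -, hp⟩ := h
  obtain ⟨q, -, -, hq⟩ := h'
  refine ⟨_, (p.append q).bypass, Walk.bypass_isPath _, rfl, fun x hx => ?_⟩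
  have := Walk.support_bypass_subset_support _ hx
  rw [Walk.mem_support_append_iff] at this
  exact this.elim (hp x) (hq x)

lemma of_adj_mem (h : G.Adj u v) (hu : u ∈ S) (hv : v ∈ S) : PathIn G S 1 u v :=
  (of_adj h).mono (by rintro x (rfl | rfl) <;> assumption)

end PathIn

/-- `G` contains three internally disjoint even paths between two distinct vertices. -/
def HasEvenTheta (G : SimpleGraph V) : Prop :=
  ∃ (s t : V) (S : Fin 3 → Set V) (n : Fin 3 → ℕ), s ≠ t ∧ (∀ i, Even (n i)) ∧
    (∀ i, PathIn G (S i) (n i) s t) ∧ ∀ i j, i ≠ j → S i ∩ S j ⊆ {s, t}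

/-- From a walk reaching `S`, extract a path meeting `S` only at its last vertex. -/
lemma exists_path_to_set {G : SimpleGraph V} {S : Set V} {u v : V} (p : G.Walk u v) (hv : v ∈ S) :
    ∃ c ∈ S, ∃ q : G.Walk u c, q.IsPath ∧ (∀ w ∈ q.support, w ∈ p.support) ∧
      ∀ w ∈ q.support, w ∈ S → w = c := by
  classical
  induction p with
  | nil => exact ⟨_, hv, .nil, by simp⟩
  | @cons u u' v h p ih =>
    obtain ⟨c, hc, q, hq, hqp, hqS⟩ := ih hv
    by_cases hu : u ∈ S
    · exact ⟨u, hu, .nil, by simp⟩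
    by_cases huq : u ∈ q.support
    · exact ⟨c, hc, q.dropUntil u huq, hq.dropUntil huq,
        fun w hw => by simp [hqp w (q.support_dropUntil_subset_support huq hw)],
        fun w hw => hqS w (q.support_dropUntil_subset_support huq hw)⟩
    · refine ⟨c, hc, .cons h q, by simp [hq, huq], ?_, ?_⟩
      · simp only [Walk.support_cons, List.mem_cons]
        exact fun w hw => hw.imp_right (hqp w)
      · simp only [Walk.support_cons, List.mem_cons]
        rintro w (rfl | hw) hwS
        · exact absurd hwS hu
        · exact hqS w hw hwS

/-- Two internally disjoint paths with the same ends, not both a single edge, form a cycle. -/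
lemma exists_isCycle_of_paths {G : SimpleGraph V} {u v : V} (p q : G.Walk u v) (hp : p.IsPath)
    (hq : q.IsPath) (hpq : ∀ w ∈ p.support, w ∈ q.support → w = u ∨ w = v)
    (hl : 2 ≤ p.length) (huv : u ≠ v) :
    ∃ c : G.Walk u u, c.IsCycle ∧ c.length = p.length + q.length ∧
      ∀ w, w ∈ c.support ↔ w ∈ p.support ∨ w ∈ q.support := by
  cases q with
  | nil => exact absurd rfl huv
  | @cons _ u' _ h q =>
    rw [Walk.cons_isPath_iff] at hq
    have hr : (q.append p.reverse).IsPath := by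
      refine isPath_append_of_inter hq.1 hp.reverse fun x hx hx' => ?_
      rw [Walk.support_reverse, List.mem_reverse] at hx'
      refine (hpq x hx' (by simp [hx])).resolve_left ?_
      rintro rfl
      exact hq.2 hx
    refine ⟨.cons h (q.append p.reverse), ?_, by simp; omega, ?_⟩
    · rw [Walk.cons_isCycle_iff]
      refine ⟨hr, fun he => ?_⟩
      rw [Sym2.eq_swap] at he
      have := hr.length_eq_one_of_mem_edges he
      simp at this
      omega
    · intro w
      simp only [Walk.support_cons, List.mem_cons, Walk.mem_support_append_iff,
        Walk.support_reverse, List.mem_reverse]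
      have : u ∈ p.support := p.start_mem_support
      grind

/-- `σ` restricts on `S` to the partner map of a perfect matching of `G[S]`. -/
def MatchesOn (G : SimpleGraph V) (S : Set V) (σ : V → V) : Prop :=
  ∀ v ∈ S, σ v ∈ S ∧ G.Adj v (σ v) ∧ σ (σ v) = v

namespace MatchesOn

variable {G : SimpleGraph V} {S T : Set V} {σ τ : V → V}

lemma even_ncard [Finite V] (h : MatchesOn G S σ) : Even S.ncard := by
  classical
  have := Fintype.ofFinite V
  have key : ∀ n : ℕ, ∀ S : Finset V, S.card = n → MatchesOn G (S : Set V) σ → Even n := by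
    intro n
    induction n using Nat.strong_induction_on with
    | _ n ih =>
      intro S hn hS
      rcases S.eq_empty_or_nonempty with rfl | ⟨v, hv⟩
      · simp at hn
        simp [← hn]
      · have hv' := hS v hv
        have hne := hv'.2.1.ne
        have hc : ((S.erase v).erase (σ v)).card + 2 = n := by
          rw [Finset.card_erase_of_mem (by simp [hne.symm]; exact hv'.1),
            Finset.card_erase_of_mem hv]
          have : 1 < S.card := Finset.one_lt_card.2 ⟨v, hv, σ v, hv'.1, hne⟩
          omega
        have := ih _ (by omega) ((S.erase v).erase (σ v)) rfl (by
          intro w hw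
          have hw' := hS w
          simp only [Finset.coe_erase, Set.mem_sdiff, Finset.mem_coe,
            Set.mem_singleton_iff] at hw hw' ⊢
          grind)
        rw [← hc]
        exact this.add (by decide)
  have := key _ S.toFinset rfl (by simpa using h)
  rwa [Set.ncard_eq_toFinset_card']

lemma union (h : MatchesOn G S σ) (h' : MatchesOn G T τ) (hd : ∀ v ∈ S, v ∉ T) :
    ∃ ρ, MatchesOn G (S ∪ T) ρ ∧ (∀ v ∈ S, ρ v = σ v) ∧ ∀ v ∈ T, ρ v = τ v := by
  classical
  refine ⟨fun v => if v ∈ S then σ v else τ v, ?_, by grind, by grind⟩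
  intro v hv
  have := h v
  have := h' v
  have := hd v
  have := hd (σ v)
  have := hd (τ v)
  simp only [Set.mem_union] at hv ⊢
  grind

lemma pair {u v : V} (h : G.Adj u v) : ∃ σ, MatchesOn G {u, v} σ ∧ σ u = v := by
  classical
  refine ⟨fun w => if w = u then v else u, ?_, by simp⟩
  intro w hw
  have := h.symm
  have := h.ne
  simp only [Set.mem_insert_iff, Set.mem_singleton_iff] at hw ⊢
  grind

/-- Restricting a matching to a subset closed under it. -/
lemma restrict (h : MatchesOn G S σ) (hT : T ⊆ S) (hc : ∀ v ∈ T, σ v ∈ T) : MatchesOn G T σ :=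
  fun v hv => ⟨hc v hv, (h v (hT hv)).2⟩

end MatchesOn

lemma exists_matchesOn_path {G : SimpleGraph V} {u v : V} (p : G.Walk u v) (hp : p.IsPath) :
    (Even p.length → ∃ σ, MatchesOn G {w | w ∈ p.support ∧ w ≠ u} σ) ∧
    (Odd p.length → ∃ σ, MatchesOn G {w | w ∈ p.support} σ) := by
  induction p with
  | nil => exact ⟨fun _ => ⟨id, by intro w; simp⟩, by simp⟩
  | @cons u u' v h p ih =>
    rw [Walk.cons_isPath_iff] at hp
    obtain ⟨ih1, ih2⟩ := ih hp.1
    constructor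
    · intro he
      obtain ⟨σ, hσ⟩ := ih2 (by simpa [Nat.even_add_one] using he)
      refine ⟨σ, ?_⟩
      convert hσ using 2 with w
      ext w
      simp
      grind
    · intro ho
      obtain ⟨σ, hσ⟩ := ih1 (by simpa [Nat.odd_add_one] using ho)
      obtain ⟨τ, hτ, -⟩ := MatchesOn.pair h
      obtain ⟨ρ, hρ, -⟩ := hτ.union hσ (by simp; grind)
      refine ⟨ρ, ?_⟩
      convert hρ using 2
      ext w
      have := p.start_mem_support
      simp
      grind

lemma exists_matchesOn_of_isMatching {G : SimpleGraph V} {M : G.Subgraph}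
    (hM : M.IsMatching) : ∃ σ, MatchesOn G M.verts σ ∧ ∀ v w, M.Adj v w → σ v = w := by
  classical
  have key : ∃ σ : V → V, ∀ v w, M.Adj v w → σ v = w := by
    refine ⟨fun v => if h : ∃ w, M.Adj v w then h.choose else v, fun v w h => ?_⟩
    have h' : ∃ w, M.Adj v w := ⟨w, h⟩
    simp only [h', dif_pos]
    exact hM.eq_of_adj_left h'.choose_spec h
  obtain ⟨σ, hσ⟩ := key
  refine ⟨σ, fun v hv => ?_, hσ⟩
  obtain ⟨w, hw, -⟩ := hM hv
  rw [hσ v w hw]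
  exact ⟨M.edge_vert hw.symm, M.adj_sub hw, hσ w v hw.symm⟩

lemma MatchesOn.exists_isPerfectMatching {G : SimpleGraph V} {σ : V → V}
    (h : MatchesOn G Set.univ σ) :
    ∃ M : G.Subgraph, M.IsPerfectMatching ∧ ∀ v w, M.Adj v w ↔ σ v = w := by
  refine ⟨{ verts := Set.univ, Adj := fun v w => σ v = w,
             adj_sub := ?_, edge_vert := ?_, symm := ?_ },
    ⟨?_, ?_⟩, ?_⟩
  · rintro v w rfl
    exact (h v trivial).2.1
  · simp
  · exact ⟨fun v w hvw => hvw ▸ (h v trivial).2.2⟩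
  · intro v _
    exact ⟨σ v, rfl, fun w (hw : σ v = w) => hw.symm⟩
  · intro v
    trivial
  · simp

/-- Recognising a subdivision of `K₃,₃` from nine paths. -/
lemma containsSubdivision_K33 {G : SimpleGraph V} (f g : Fin 3 → V) (hf : f.Injective)
    (hg : g.Injective) (hfg : ∀ i j, f i ≠ g j) (T : Fin 3 → Fin 3 → Set V)
    (hT : ∀ i j, ∃ n, PathIn G (T i j) n (f i) (g j))
    (h₁ : ∀ i j j', j ≠ j' → T i j ∩ T i j' ⊆ {f i})
    (h₂ : ∀ i i' j, i ≠ i' → T i j ∩ T i' j ⊆ {g j})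
    (h₃ : ∀ i i' j j', i ≠ i' → j ≠ j' → T i j ∩ T i' j' = ∅) :
    ContainsSubdivision G (completeBipartiteGraph (Fin 3) (Fin 3)) := by
  choose n q hq hn hqT using hT
  let F : Fin 3 ⊕ Fin 3 → V := Sum.elim f g
  have hF : F.Injective := hf.sumElim hg hfg
  let p : ∀ a b, (completeBipartiteGraph (Fin 3) (Fin 3)).Adj a b → G.Walk (F a) (F b)
    | .inl i, .inr j, _ => q i j
    | .inr j, .inl i, _ => (q i j).reverse
    | .inl _, .inl _, h => absurd h (by simp)
    | .inr _, .inr _, h => absurd h (by simp)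
  have hp : ∀ a b h, ∃ i j, s(a, b) = s(.inl i, .inr j) ∧ (p a b h).IsPath ∧
      ∀ w, w ∈ (p a b h).support → w ∈ T i j := by
    rintro (i | j) (i' | j') h
    · simp at h
    · exact ⟨i, j', rfl, hq _ _, hqT i j'⟩
    · exact ⟨i', j, Sym2.eq_swap, (hq _ _).reverse, fun w hw => 
        hqT i' j w ((List.mem_reverse.1 (by rw [← Walk.support_reverse]; exact hw)))⟩
    · simp at h
  have hdisj : ∀ i j i' j', (i ≠ i' ∨ j ≠ j') → ∀ w, w ∈ T i j → w ∈ T i' j' →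
      (w = f i ∨ w = g j) ∧ (w = f i' ∨ w = g j') := by
    intro i j i' j' hne w hw hw'
    by_cases hi : i = i'
    · subst hi
      have := h₁ i j j' (by simpa using hne) ⟨hw, hw'⟩
      simp only [Set.mem_singleton_iff] at this
      simp [this]
    · by_cases hj : j = j'
      · subst hj
        have := h₂ i i' j hi ⟨hw, hw'⟩
        simp only [Set.mem_singleton_iff] at this
        simp [this]
      · have : w ∈ T i j ∩ T i' j' := ⟨hw, hw'⟩
        simp [h₃ i i' j j' hi hj] at this
  have hends : ∀ i j, f i ∈ T i j ∧ g j ∈ T i j := fun i j =>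
    ⟨hqT i j _ (q i j).start_mem_support, hqT i j _ (q i j).end_mem_support⟩
  refine ⟨⟨F, hF⟩, p, fun a b h => (hp a b h).choose_spec.choose_spec.2.1, fun _ _ _ => trivial,
    ?_, ?_⟩
  · intro a b h c hc
    obtain ⟨i, j, hab, -, hS⟩ := hp a b h
    have hc := hS _ hc
    have : c = .inl i ∨ c = .inr j := by
      rcases c with i' | j'
      · by_cases hi : i' = i
        · exact .inl (congrArg _ hi)
        · have := hdisj i j i' j (.inl (Ne.symm hi)) (f i') hc (hends i' j).1
          rcases this.1 with h | h
          · exact absurd (hf h) hi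
          · exact absurd h (hfg _ _)
      · by_cases hj : j' = j
        · exact .inr (congrArg _ hj)
        · have := hdisj i j i j' (.inr (Ne.symm hj)) (g j') hc (hends i j').2
          rcases this.1 with h | h
          · exact absurd h.symm (hfg _ _)
          · exact absurd (hg h) hj
    have hm : c ∈ s(a, b) := by rw [hab]; simpa using this
    simpa using hm
  · intro a b h a' b' h' hne w hw hw'
    obtain ⟨i, j, hab, -, hS⟩ := hp a b h
    obtain ⟨i', j', hab', -, hS'⟩ := hp a' b' h'
    have hd := hdisj i j i' j' (by
      by_contra! hcon
      exact hne (by rw [hab, hab', hcon.1, hcon.2])) w (hS w hw) (hS' w hw')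
    have tr : ∀ (a b : Fin 3 ⊕ Fin 3) (i j : Fin 3), s(a, b) = s(.inl i, .inr j) →
        (w = f i ∨ w = g j) → w = F a ∨ w = F b := by
      intro a b i j hab hw
      rw [Sym2.eq_iff] at hab
      rcases hab with ⟨rfl, rfl⟩ | ⟨rfl, rfl⟩
      · exact hw
      · exact hw.symm
    exact ⟨tr a b i j hab hd.1, tr a' b' i' j' hab' hd.2⟩

lemma takeUntil_inter_dropUntil [DecidableEq V] {G : SimpleGraph V} {u v c : V} {p : G.Walk u v}
    (hp : p.IsPath) (hc : c ∈ p.support) :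
    ∀ x ∈ (p.takeUntil c hc).support, x ∈ (p.dropUntil c hc).support → x = c := by
  intro x hx hx'
  by_contra hne
  have h : ((p.takeUntil c hc).append (p.dropUntil c hc)).IsPath := by rwa [Walk.take_spec]
  exact h.ne_of_mem_support_of_append hne hx hx' rfl

/-- Three vertices that can be joined inside `D` are the leaves of a subdivided claw in `D`. -/
lemma exists_tripod {G : SimpleGraph V} {D : Set V} (d : Fin 3 → V)
    (h : ∀ i j, ∃ n, PathIn G D n (d i) (d j)) :
    ∃ (c : V) (L : Fin 3 → Set V), (∀ i, ∃ n, PathIn G (L i) n c (d i)) ∧ (∀ i, L i ⊆ D) ∧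
      ∀ i j, i ≠ j → L i ∩ L j ⊆ {c} := by
  classical
  obtain ⟨n, p, hp, -, hpD⟩ := h 0 1
  obtain ⟨m, r, -, -, hrD⟩ := h 2 0
  obtain ⟨c, hc, q, hq, hqr, hqS⟩ := exists_path_to_set r (S := {w | w ∈ p.support}) (by simp)
  have htd := takeUntil_inter_dropUntil hp hc
  refine ⟨c, ![{w | w ∈ (p.takeUntil c hc).support}, {w | w ∈ (p.dropUntil c hc).support},
    {w | w ∈ q.support}], ?_, ?_, ?_⟩
  · intro i
    fin_cases i
    · exact ⟨_, (p.takeUntil c hc).reverse, (hp.takeUntil hc).reverse, rfl, by simp⟩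
    · exact ⟨_, (p.dropUntil c hc), (hp.dropUntil hc), rfl, by simp⟩
    · exact ⟨_, q.reverse, hq.reverse, rfl, by simp⟩
  · intro i
    fin_cases i
    · exact fun x hx => hpD x (p.support_takeUntil_subset_support hc hx)
    · exact fun x hx => hpD x (p.support_dropUntil_subset_support hc hx)
    · exact fun x hx => hrD x (hqr x hx)
  · have h1 : ∀ x ∈ (p.takeUntil c hc).support, x ∈ q.support → x = c :=
      fun x hx hx' => hqS x hx' (p.support_takeUntil_subset_support hc hx)
    have h2 : ∀ x ∈ (p.dropUntil c hc).support, x ∈ q.support → x = c :=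
      fun x hx hx' => hqS x hx' (p.support_dropUntil_subset_support hc hx)
    intro i j hij x ⟨hx, hx'⟩
    fin_cases i <;> fin_cases j <;> simp at hij hx hx' ⊢ <;> first
      | exact htd x hx hx' | exact htd x hx' hx | exact h1 x hx hx' | exact h1 x hx' hx
      | exact h2 x hx hx' | exact h2 x hx' hx

/-- A component of the complement of a theta attached to the interiors of all three paths
produces a subdivision of `K₃,₃`. -/
lemma containsSubdivision_K33_of_theta {G : SimpleGraph V} {s t : V} (hst : s ≠ t)
    (p : Fin 3 → G.Walk s t) (hp : ∀ i, (p i).IsPath)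
    (hpp : ∀ i j, i ≠ j → ∀ w ∈ (p i).support, w ∈ (p j).support → w = s ∨ w = t)
    (v : V) (d x : Fin 3 → V)
    (hd : ∀ i, ∃ n, PathIn G {w | ∀ i, w ∉ (p i).support} n v (d i))
    (hdx : ∀ i, G.Adj (d i) (x i)) (hx : ∀ i, x i ∈ (p i).support)
    (hxs : ∀ i, x i ≠ s) (hxt : ∀ i, x i ≠ t) :
    ContainsSubdivision G (completeBipartiteGraph (Fin 3) (Fin 3)) := by
  classical
  obtain ⟨c, L, hL, hLD, hLL⟩ := exists_tripod d (fun i j => by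
    obtain ⟨n, hn⟩ := hd i
    obtain ⟨m, hm⟩ := hd j
    exact hn.symm.trans hm)
  have hL' : ∀ i y, y ∈ L i → ∀ j, y ∉ (p j).support := fun i y hy => hLD i hy
  have hcL : ∀ i, c ∈ L i := fun i => by obtain ⟨n, hn⟩ := hL i; exact hn.left_mem
  have hdL : ∀ i, d i ∈ L i := fun i => by obtain ⟨n, hn⟩ := hL i; exact hn.right_mem
  have hc := hL' 0 c (hcL 0)
  have hs : ∀ i, s ∈ (p i).support := fun i => (p i).start_mem_support
  have ht : ∀ i, t ∈ (p i).support := fun i => (p i).end_mem_support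
  have hxx : ∀ i j, i ≠ j → x i ∉ (p j).support := fun i j hij h =>
    (hpp i j hij _ (hx i) h).elim (hxs i) (hxt i)
  have htake : ∀ j, ∀ y ∈ ((p j).takeUntil _ (hx j)).support, y ∈ (p j).support ∧ y ≠ t :=
    fun j y hy => ⟨(p j).support_takeUntil_subset_support (hx j) hy, by
      rintro rfl
      exact Walk.endpoint_notMem_support_takeUntil (hp j) (hx j) (hxt j).symm hy⟩
  have hdrop : ∀ j, ∀ y ∈ ((p j).dropUntil _ (hx j)).support, y ∈ (p j).support ∧ y ≠ s :=
    fun j y hy => ⟨(p j).support_dropUntil_subset_support (hx j) hy, by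
      rintro rfl
      exact hxs j (takeUntil_inter_dropUntil (hp j) (hx j) y
        (Walk.start_mem_support _) hy).symm⟩
  have htd := fun j => takeUntil_inter_dropUntil (hp j) (hx j)
  let T : Fin 3 → Fin 3 → Set V := ![fun j => {y | y ∈ ((p j).takeUntil _ (hx j)).support},
      fun j => {y | y ∈ ((p j).dropUntil _ (hx j)).support},
      fun j => L j ∪ {d j, x j}]
  refine containsSubdivision_K33 ![s, t, c] x ?_ ?_ ?_ T ?_ ?_ ?_ ?_
  · have h1 : s ≠ c := fun h => hc 0 (h ▸ hs 0)
    have h2 : t ≠ c := fun h => hc 0 (h ▸ ht 0)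
    intro i j hij
    fin_cases i <;> fin_cases j <;> simp at hij ⊢ <;> grind
  · intro i j hij
    by_contra hne
    exact hxx i j hne (hij ▸ hx j)
  · intro i j
    have h1 : c ≠ x j := fun h => hc j (h ▸ hx j)
    have := hxs j
    have := hxt j
    fin_cases i <;> simp <;> grind
  · intro i j
    fin_cases i
    · exact ⟨_, (p j).takeUntil _ (hx j), (hp j).takeUntil _, rfl, by simp [T]⟩
    · exact ⟨_, ((p j).dropUntil _ (hx j)).reverse, ((hp j).dropUntil _).reverse, rfl, by simp [T]⟩
    · obtain ⟨n, hn⟩ := hL j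
      refine ⟨_, hn.append (PathIn.of_adj (hdx j)) ?_⟩
      rintro y ⟨hy, rfl | rfl⟩
      · rfl
      · exact absurd (hx j) (hL' j _ hy j)
  · rintro i j j' hj y ⟨hy, hy'⟩
    have h1 := htake j y
    have h2 := htake j' y
    have h3 := hdrop j y
    have h4 := hdrop j' y
    have h5 := hpp j j' hj y
    have h6 := hL' j y
    have h7 := hL' j' y
    have h8 : y ∈ L j → y ∈ L j' → y = c := fun h h' => hLL j j' hj ⟨h, h'⟩
    have := hdL j
    have := hdL j'
    have := hx j
    have := hx j'
    have := hxx j j' hj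
    fin_cases i <;> simp [T] at hy hy' ⊢ <;> grind
  · have key : ∀ i i' j, i < i' → ∀ y, y ∈ T i j → y ∈ T i' j → y = x j := by
      intro i i' j hi y hy hy'
      have h1 := htake j y
      have h3 := hdrop j y
      have h6 := hL' j y
      have := hdL j
      have := hx j
      have := htd j y
      fin_cases i <;> fin_cases i' <;> simp [T] at hi hy hy' ⊢ <;> grind
    rintro i i' j hi y ⟨hy, hy'⟩
    rcases lt_or_gt_of_ne hi with hi | hi
    · exact key i i' j hi y hy hy'
    · exact key i' i j hi y hy' hy
  · intro i i' j j' hi hj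
    rw [Set.eq_empty_iff_forall_notMem]
    rintro y ⟨hy, hy'⟩
    have h1 := htake j y
    have h2 := htake j' y
    have h3 := hdrop j y
    have h4 := hdrop j' y
    have h5 := hpp j j' hj y
    have h6 := hL' j y
    have h7 := hL' j' y
    have := hdL j
    have := hdL j'
    have := hx j
    have := hx j'
    have := hxx j j' hj
    have := hxx j' j hj.symm
    fin_cases i <;> fin_cases i' <;> simp [T] at hi hy hy' <;> grind

lemma ConformalCycle.exists_matchesOn {G : SimpleGraph V} {u : V} {c : G.Walk u u}
    (h : ConformalCycle G c) : ∃ σ, MatchesOn G {w | w ∉ c.support} σ := by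
  obtain ⟨M, hM, hMv⟩ := h
  obtain ⟨σ, hσ, -⟩ := exists_matchesOn_of_isMatching hM
  exact ⟨σ, hMv ▸ hσ⟩

/-- A planar cycle-extendable graph contains no even theta, i.e. it is not `K₂,₃`-based. -/
lemma not_hasEvenTheta [Finite V] {G : SimpleGraph V} (hplanar : IsPlanar G)
    (hce : CycleExtendable G) : ¬ HasEvenTheta G := by
  classical
  rintro ⟨s, t, S, n, hst, hn, hS, hSS⟩
  choose p hp hlen hpS using hS
  have hpp : ∀ i j, i ≠ j → ∀ w ∈ (p i).support, w ∈ (p j).support → w = s ∨ w = t :=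
    fun i j hij w hw hw' => hSS i j hij ⟨hpS i w hw, hpS j w hw'⟩
  have hs : ∀ i, s ∈ (p i).support := fun i => (p i).start_mem_support
  have ht : ∀ i, t ∈ (p i).support := fun i => (p i).end_mem_support
  have hpe : ∀ i, Even (p i).length := fun i => hlen i ▸ hn i
  have hp2 : ∀ i, 2 ≤ (p i).length := by
    intro i
    have : (p i).length ≠ 0 := fun h => hst (Walk.eq_of_length_eq_zero h)
    have := hpe i
    grind
  let Θ : Set V := {w | ∀ i, w ∉ (p i).support}
  let att : V → Fin 3 → Prop := fun v k => ∃ d x m, PathIn G Θ m v d ∧ G.Adj d x ∧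
    x ∈ (p k).support ∧ x ≠ s ∧ x ≠ t
  have hatt : ∀ v, ∃ k, ¬ att v k := by
    intro v
    by_contra! h
    choose d x m hd hdx hx hxs hxt using h
    exact hplanar.2 (containsSubdivision_K33_of_theta hst p hp hpp v d x (fun i => ⟨_, hd i⟩)
      hdx hx hxs hxt)
  have hσ : ∀ k, ∃ σ, MatchesOn G {w | ∀ j, j ≠ k → w ∉ (p j).support} σ := by
    intro k
    obtain ⟨c, hc, hcl, hcs⟩ := exists_isCycle_of_paths (p (k + 1)) (p (k + 2)) (hp _) (hp _)
      (hpp _ _ (by simp)) (hp2 _) hst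
    obtain ⟨σ, hσ⟩ := (hce c hc (by rw [hcl]; exact (hpe _).add (hpe _))).exists_matchesOn
    refine ⟨σ, ?_⟩
    convert hσ using 2
    ext w
    simp only [hcs]
    fin_cases k
    · simp [Fin.forall_fin_succ]
    · simp [Fin.forall_fin_succ, and_comm]
    · simp [Fin.forall_fin_succ]
  choose σ hσ using hσ
  obtain ⟨κ', hκ'⟩ : ∃ κ' : (Fin 3 → Prop) → Fin 3,
      ∀ P : Fin 3 → Prop, (∃ k, ¬ P k) → ¬ P (κ' P) :=
    ⟨fun P => if h : ∃ k, ¬ P k then h.choose else 0, fun P h => by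
      simp only [h, dif_pos]; exact h.choose_spec⟩
  have hadj : ∀ v w, v ∈ Θ → w ∈ Θ → G.Adj v w → ∀ k, att w k → att v k := by
    rintro v w hv hw hvw k ⟨d, x, m, hd, h⟩
    obtain ⟨m', hm'⟩ := (PathIn.of_adj_mem hvw hv hw).trans hd
    exact ⟨d, x, m', hm', h⟩
  have hΘ : MatchesOn G Θ (fun v => σ (κ' (att v)) v) := by
    intro v hv
    have hk := hκ' (att v) (hatt v)
    change σ (κ' (att v)) v ∈ Θ ∧ G.Adj v (σ (κ' (att v)) v) ∧
      σ (κ' (att (σ (κ' (att v)) v))) (σ (κ' (att v)) v) = v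
    obtain ⟨k, hkdef⟩ : ∃ k, k = κ' (att v) := ⟨_, rfl⟩
    rw [← hkdef] at hk ⊢
    obtain ⟨h1, h2, h3⟩ := hσ k v (fun j _ => hv j)
    have hmem : σ k v ∈ Θ := by
      intro j hj
      by_cases hjk : j = k
      · rw [hjk] at hj
        obtain ⟨j', hj'⟩ : ∃ j', j' ≠ k := exists_ne k
        refine hk ⟨v, σ k v, 0, PathIn.refl hv, h2, hj, ?_, ?_⟩
        · exact fun h => h1 j' hj' (h ▸ hs j')
        · exact fun h => h1 j' hj' (h ▸ ht j')
      · exact h1 j hjk hj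
    have hatteq : att (σ k v) = att v := funext fun j => propext
      ⟨hadj _ _ hv hmem h2 j, hadj _ _ hmem hv h2.symm j⟩
    refine ⟨hmem, h2, ?_⟩
    rw [hatteq, ← hkdef, h3]
  have e1 := hΘ.even_ncard
  have e2 := (hσ 0).even_ncard
  obtain ⟨τ, hτ⟩ := (exists_matchesOn_path (p 0) (hp 0)).1 (hpe 0)
  have e3 := hτ.even_ncard
  have hunion : {w | ∀ j, j ≠ 0 → w ∉ (p j).support} ∪ {t} =
      Θ ∪ {w | w ∈ (p 0).support ∧ w ≠ s} := by
    ext w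
    have := hpp 0 1 (by decide) w
    have := hpp 0 2 (by decide) w
    have := hs 1
    have := ht 0
    simp [Θ, Fin.forall_fin_succ]
    grind
  have hc := congrArg Set.ncard hunion
  rw [Set.ncard_union_eq (by
      rw [Set.disjoint_singleton_right]
      exact fun h => h 1 (by decide) (ht 1)),
    Set.ncard_union_eq (by
      rw [Set.disjoint_left]
      exact fun w hw hw' => hw 0 hw'.1), Set.ncard_singleton] at hc
  have := e1.add e3
  rw [← hc] at this
  grind

lemma HasEvenTheta.of_paths {G : SimpleGraph V} {s t : V} {S₀ S₁ S₂ : Set V} {n₀ n₁ n₂ : ℕ}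
    (hst : s ≠ t) (h₀ : PathIn G S₀ n₀ s t) (h₁ : PathIn G S₁ n₁ s t) (h₂ : PathIn G S₂ n₂ s t)
    (e₀ : Even n₀) (e₁ : Even n₁) (e₂ : Even n₂) (h₀₁ : ∀ x ∈ S₀, x ∈ S₁ → x = s ∨ x = t)
    (h₀₂ : ∀ x ∈ S₀, x ∈ S₂ → x = s ∨ x = t) (h₁₂ : ∀ x ∈ S₁, x ∈ S₂ → x = s ∨ x = t) :
    HasEvenTheta G := by
  refine ⟨s, t, ![S₀, S₁, S₂], ![n₀, n₁, n₂], hst, ?_, ?_, ?_⟩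
  · intro i
    fin_cases i <;> simpa
  · intro i
    fin_cases i <;> simpa
  · intro i j hij x ⟨hx, hx'⟩
    fin_cases i <;> fin_cases j <;> simp at hij hx hx' ⊢ <;> grind

/-- The vertices `u 0, …, u n` form a path alternating between `A` and `B`, starting in `A`. -/
structure IsAlternating (G : SimpleGraph V) (A B : Set V) (u : ℕ → V) (n : ℕ) : Prop where
  inj : ∀ i ≤ n, ∀ j ≤ n, u i = u j → i = j
  adj : ∀ k < n, G.Adj (u k) (u (k + 1))
  mem_left : ∀ k ≤ n, k % 2 = 0 → u k ∈ A
  mem_right : ∀ k ≤ n, k % 2 = 1 → u k ∈ B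

/-- From the start `u 0` of an alternating path, one returns to the path at `u i` through the
vertex `b`, which is either `u i` itself or a neighbour of `u i` off the path. -/
structure LandsAt (G : SimpleGraph V) (B : Set V) (u : ℕ → V) (n : ℕ) (b : V) (i : ℕ) : Prop where
  two_le : 2 ≤ i
  le : i ≤ n
  adj : G.Adj (u 0) b
  cases : (b = u i ∧ i % 2 = 1) ∨ ((∀ k ≤ n, u k ≠ b) ∧ i % 2 = 0 ∧ G.Adj b (u i))

namespace IsAlternating

variable {G : SimpleGraph V} {A B : Set V} {u : ℕ → V} {n : ℕ}

lemma pathIn (h : IsAlternating G A B u n) {i j : ℕ} (hij : i ≤ j) (hj : j ≤ n) :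
    PathIn G (u '' Set.Icc i j) (j - i) (u i) (u j) := by
  induction j, hij using Nat.le_induction with
  | base => simpa using PathIn.refl (by simp)
  | succ j hij ih =>
    have := (ih (by omega)).append (PathIn.of_adj (h.adj j (by omega))) (by
      rintro x ⟨⟨k, hk, rfl⟩, hx | hx⟩
      · exact hx
      · have := h.inj k (by have := hk.2; omega) _ hj hx
        have := hk.2
        omega)
    rw [show j + 1 - i = j - i + 1 by omega]
    refine this.mono ?_
    rintro x (⟨k, hk, rfl⟩ | rfl | rfl)
    · exact ⟨k, ⟨hk.1, by have := hk.2; omega⟩, rfl⟩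
    · exact ⟨j, ⟨hij, by omega⟩, rfl⟩
    · exact ⟨j + 1, ⟨by omega, le_rfl⟩, rfl⟩

lemma pathIn_uIcc (h : IsAlternating G A B u n) {i j : ℕ} (hi : i ≤ n) (hj : j ≤ n) :
    ∃ e, (e + i + j) % 2 = 0 ∧ PathIn G (u '' Set.Icc (min i j) (max i j)) e (u i) (u j) := by
  rcases le_total i j with hij | hij
  · exact ⟨j - i, by omega, by simpa [hij] using h.pathIn hij hj⟩
  · exact ⟨i - j, by omega, by simpa [hij] using (h.pathIn hij hi).symm⟩

lemma lt_card [Fintype V] (h : IsAlternating G A B u n) : n < Fintype.card V := by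
  have : Function.Injective (fun k : Fin (n + 1) => u k) := by
    intro i j hij
    exact Fin.ext (h.inj _ (by omega) _ (by omega) hij)
  simpa using Fintype.card_le_of_injective _ this

/-- Reversing the initial segment of an alternating path along a chord at its start. -/
lemma rotate (h : IsAlternating G A B u n) {i : ℕ} (hi : i ≤ n) (hi2 : i % 2 = 1)
    (hadj : G.Adj (u 0) (u i)) :
    IsAlternating G A B (fun k => if k < i then u (i - 1 - k) else u k) n := by
  constructor
  · intro k hk l hl
    have h1 := h.inj k hk l hl
    have h2 := h.inj (i - 1 - k) (by omega) l hl
    have h3 := h.inj k hk (i - 1 - l) (by omega)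
    have h4 := h.inj (i - 1 - k) (by omega) (i - 1 - l) (by omega)
    split_ifs <;> intro he
    · have := h4 he; omega
    · have := h2 he; omega
    · have := h3 he; omega
    · exact h1 he
  · intro k hk
    rcases lt_trichotomy (k + 1) i with hlt | heq | hgt
    · rw [if_pos (by omega), if_pos hlt]
      have := (h.adj (i - 1 - (k + 1)) (by omega)).symm
      rwa [show i - 1 - (k + 1) + 1 = i - 1 - k by omega] at this
    · rw [if_pos (by omega), if_neg (by omega), show i - 1 - k = 0 by omega, heq]
      exact hadj
    · rw [if_neg (by omega), if_neg (by omega)]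
      exact h.adj k hk
  · intro k hk hk2
    split_ifs
    · exact h.mem_left _ (by omega) (by omega)
    · exact h.mem_left _ hk hk2
  · intro k hk hk2
    split_ifs
    · exact h.mem_right _ (by omega) (by omega)
    · exact h.mem_right _ hk hk2

lemma exists_landsAt (h : IsAlternating G A B u n) (hAB : ∀ a ∈ A, a ∉ B)
    (hmax : ∀ u' m, IsAlternating G A B u' m → m ≤ n)
    (hB : ∀ b ∈ B, ∀ x, ∃ a ∈ A, G.Adj b a ∧ a ≠ x) {b : V} (hb : b ∈ B) (hadj : G.Adj (u 0) b)
    (hb1 : b ≠ u 1) : ∃ i, LandsAt G B u n b i := by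
  by_cases hon : ∃ k ≤ n, u k = b
  · obtain ⟨k, hk, rfl⟩ := hon
    have hk2 : k % 2 = 1 := by
      by_contra hne
      exact hAB _ (h.mem_left k hk (by omega)) hb
    have : k ≠ 1 := by rintro rfl; exact hb1 rfl
    exact ⟨k, by omega, hk, hadj, .inl ⟨rfl, hk2⟩⟩
  push Not at hon
  obtain ⟨a, ha, hba, ha0⟩ := hB b hb (u 0)
  by_cases hona : ∃ k ≤ n, u k = a
  · obtain ⟨k, hk, rfl⟩ := hona
    have hk2 : k % 2 = 0 := by
      by_contra hne
      exact hAB _ ha (h.mem_right k hk (by omega))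
    have : k ≠ 0 := by rintro rfl; exact ha0 rfl
    exact ⟨k, by omega, hk, hadj, .inr ⟨hon, hk2, hba⟩⟩
  push Not at hona
  exfalso
  have : n + 2 ≤ n := hmax (fun k => if k = 0 then a else if k = 1 then b else u (k - 2)) _ (by
    have hab := hba.ne
    constructor
    · intro k hk l hl
      have := hon (k - 2) (by omega)
      have := hon (l - 2) (by omega)
      have := hona (k - 2) (by omega)
      have := hona (l - 2) (by omega)
      have := h.inj (k - 2) (by omega) (l - 2) (by omega)
      grind
    · intro k hk
      match k with
      | 0 => simpa using hba.symm
      | 1 => simpa using hadj.symm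
      | k + 2 => simpa using h.adj k (by omega)
    · intro k hk hk2
      match k with
      | 0 => simpa using ha
      | 1 => omega
      | k + 2 => simpa using h.mem_left k (by omega) (by omega)
    · intro k hk hk2
      match k with
      | 0 => omega
      | 1 => simpa using hb
      | k + 2 => simpa using h.mem_right k (by omega) (by omega))
  omega

end IsAlternating

namespace LandsAt

variable {G : SimpleGraph V} {A B : Set V} {u : ℕ → V} {n i : ℕ} {b : V}

lemma pathIn (h : LandsAt G B u n b i) (hu : u 0 ≠ u i) :
    ∃ e, (e + i) % 2 = 0 ∧ PathIn G {u 0, b, u i} e (u 0) (u i) := by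
  rcases h.cases with ⟨rfl, hi⟩ | ⟨hon, hi, hadj⟩
  · exact ⟨1, by omega, (PathIn.of_adj h.adj).mono (by simp)⟩
  · refine ⟨2, by omega, ((PathIn.of_adj h.adj).append (PathIn.of_adj hadj) ?_).mono ?_⟩
    · rintro x ⟨rfl | hx, rfl | hx'⟩
      · rfl
      · exact absurd hx' hu
      · rfl
      · exact hx
    · intro x
      simp
      tauto

lemma eq_of_eq (h : LandsAt G B u n b i) (hu : IsAlternating G A B u n) :
    ∀ k ≤ n, u k = b → k = i := by
  intro k hk hkb
  rcases h.cases with ⟨rfl, hi⟩ | ⟨hon, hi, hadj⟩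
  · exact hu.inj k hk i h.le hkb
  · exact absurd hkb (hon k hk)

end LandsAt

/-- If every vertex of `A` has three neighbours in `B` and every vertex of `B` has two
neighbours in `A`, then there is an even theta. -/
lemma hasEvenTheta_of_degrees [Finite V] {G : SimpleGraph V} {A B : Set V}
    (hAB : ∀ a ∈ A, a ∉ B) (hne : A.Nonempty)
    (hA : ∀ a ∈ A, ∀ x y, ∃ b ∈ B, G.Adj a b ∧ b ≠ x ∧ b ≠ y)
    (hB : ∀ b ∈ B, ∀ x, ∃ a ∈ A, G.Adj b a ∧ a ≠ x) : HasEvenTheta G := by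
  classical
  have := Fintype.ofFinite V
  obtain ⟨n, ⟨u₀, hu₀⟩, hmax⟩ : ∃ n, (∃ u, IsAlternating G A B u n) ∧
      ∀ u m, IsAlternating G A B u m → m ≤ n := by
    let P : ℕ → Prop := fun n => ∃ u, IsAlternating G A B u n
    obtain ⟨a, ha⟩ := hne
    have h0 : P 0 := ⟨fun _ => a, ⟨by omega, by omega, fun _ _ _ => ha, by omega⟩⟩
    exact ⟨Nat.findGreatest P (Fintype.card V), Nat.findGreatest_spec (Nat.zero_le _) h0,
      fun u m hu => Nat.le_findGreatest hu.lt_card.le ⟨u, hu⟩⟩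
  have hex : ∃ i, ∃ u b, IsAlternating G A B u n ∧ b ≠ u 1 ∧ LandsAt G B u n b i := by
    obtain ⟨b, hb, hadj, hb1, -⟩ := hA _ (hu₀.mem_left 0 (by omega) rfl) (u₀ 1) (u₀ 1)
    obtain ⟨i, hi⟩ := hu₀.exists_landsAt hAB hmax hB hb hadj hb1
    exact ⟨i, u₀, b, hu₀, hb1, hi⟩
  obtain ⟨i, ⟨u, b, hu, hb1, hbi⟩, hmin⟩ : ∃ i,
      (∃ u b, IsAlternating G A B u n ∧ b ≠ u 1 ∧ LandsAt G B u n b i) ∧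
      ∀ u b j, IsAlternating G A B u n → b ≠ u 1 → LandsAt G B u n b j → i ≤ j :=
    ⟨Nat.find hex, Nat.find_spec hex, fun u b j h1 h2 h3 => Nat.find_min' hex ⟨u, b, h1, h2, h3⟩⟩
  obtain ⟨b', hb', hadj', hb1', hbb'⟩ := hA _ (hu.mem_left 0 (by omega) rfl) (u 1) b
  obtain ⟨j, hj⟩ := hu.exists_landsAt hAB hmax hB hb' hadj' hb1'
  have hij := hmin u b' j hu hb1' hj
  have hi2 := hbi.two_le
  have hin := hbi.le
  have hjn := hj.le
  have hinj := hu.inj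
  have hbeq := hbi.eq_of_eq hu
  have hbeq' := hj.eq_of_eq hu
  have hu0 : ∀ k ≤ n, k ≠ 0 → u 0 ≠ u k := fun k hk hk0 h => hk0 (hinj 0 (by omega) k hk h).symm
  obtain ⟨e', he', hp'⟩ := hj.pathIn (hu0 j hjn (by omega))
  rcases hbi.cases with ⟨rfl, hi⟩ | ⟨hon, hi, hadj⟩
  · have hW := hu.rotate hin hi hbi.adj
    set W : ℕ → V := fun k => if k < i then u (i - 1 - k) else u k with hWdef
    have hW0 : W 0 = u (i - 1) := by simp [hWdef]; omega
    have hW1 : W 1 = u (i - 2) := by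
      simp only [hWdef]
      rw [if_pos (by omega)]
      congr 1
    obtain ⟨c, hc, hadjc, hc1, hc2⟩ := hA _ (hu.mem_left (i - 1) (by omega) (by omega))
      (u (i - 2)) (u i)
    rw [← hW0] at hadjc
    rw [← hW1] at hc1
    obtain ⟨m, hm⟩ := hW.exists_landsAt hAB hmax hB hc hadjc hc1
    have him := hmin W c m hW hc1 hm
    have hmn := hm.le
    have hWm : W m = u m := by simp only [hWdef]; rw [if_neg (by omega)]
    have hceq : ∀ k ≤ n, u k = c → k = m := by
      intro k hk hkc
      by_cases hki : k < i
      · have := hm.eq_of_eq hW (i - 1 - k) (by omega) (by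
          simp only [hWdef]
          rw [if_pos (by omega), show i - 1 - (i - 1 - k) = k by omega, hkc])
        omega
      · exact hm.eq_of_eq hW k hk (by simp only [hWdef]; rw [if_neg hki, hkc])
    have him' : i < m := by
      refine lt_of_le_of_ne him ?_
      rintro rfl
      rcases hm.cases with ⟨h, -⟩ | ⟨-, h, -⟩
      · exact hc2 (h.trans hWm)
      · omega
    have hij' : i < j := by
      refine lt_of_le_of_ne hij ?_
      rintro rfl
      rcases hj.cases with ⟨h, -⟩ | ⟨-, h, -⟩
      · exact hbb' h
      · omega
    obtain ⟨e'', he'', hp''⟩ := hm.pathIn (by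
      rw [hW0, hWm]
      intro h
      have := hinj _ (by omega) _ hmn h
      omega)
    rw [hW0, hWm] at hp''
    rw [hW0] at hadjc
    have hadji := hu.adj (i - 1) (by omega)
    rw [show i - 1 + 1 = i by omega] at hadji
    have hst := hu0 (i - 1) (by omega) (by omega)
    have p₀ := hu.pathIn (Nat.zero_le (i - 1)) (by omega)
    have p₁ := (PathIn.of_adj hbi.adj).append (PathIn.of_adj hadji.symm) (by
      rintro x ⟨rfl | hx, hx' | hx'⟩
      · exact hx'
      · exact absurd hx' hst
      · exact hx'
      · exact hx)
    have h₀₁ : ∀ x ∈ u '' Set.Icc 0 (i - 1), x ∈ ({u 0, u i} ∪ {u i, u (i - 1)} : Set V) →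
        x = u 0 ∨ x = u (i - 1) := by
      rintro x ⟨k, hk, rfl⟩ hx
      have := hinj k (by have := hk.2; omega) i hin
      have := hk.2
      simp at hx
      grind
    by_cases hbc : b' = c
    · subst hbc
      have p₂ := (PathIn.of_adj hadj').append (PathIn.of_adj hadjc.symm) (by
        rintro x ⟨rfl | hx, hx' | hx'⟩
        · exact hx'
        · exact absurd hx' hst
        · exact hx'
        · exact hx)
      refine .of_paths hst p₀ p₁ p₂ (by rw [Nat.even_iff]; omega) (by decide) (by decide) h₀₁ ?_ ?_
      · rintro x ⟨k, hk, rfl⟩ hx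
        have := hbeq' k (by have := hk.2; omega)
        have := hk.2
        simp at hx
        grind
      · intro x hx hx'
        simp at hx hx'
        grind
    · obtain ⟨e, he, hp⟩ := hu.pathIn_uIcc hjn hmn
      have p₂ := (hp'.append hp (by
        rintro x ⟨hx, k, hk, rfl⟩
        rw [Set.mem_Icc] at hk
        have := hbeq' k (by omega)
        have := hu0 k (by omega) (by omega)
        simp at hx ⊢
        grind)).append hp''.symm (by
        rintro x ⟨hx | ⟨k, hk, rfl⟩, hx'⟩
        · have := hbeq' m hmn
          have := hceq j hjn
          have := hbeq' (i - 1) (by omega)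
          have := hceq 0 (by omega)
          have := hinj (i - 1) (by omega) j hjn
          simp at hx hx' ⊢
          grind
        · rw [Set.mem_Icc] at hk
          have := hceq k (by omega)
          have := hinj (i - 1) (by omega) k (by omega)
          simp at hx' ⊢
          grind)
      refine .of_paths hst p₀ p₁ p₂ (by rw [Nat.even_iff]; omega) (by decide)
        (by rw [Nat.even_iff]; omega) h₀₁ ?_ ?_
      · rintro x ⟨k, hk, rfl⟩ ((hx | ⟨l, hl, hx⟩) | hx)
        · rw [Set.mem_Icc] at hk
          have := hbeq' k (by omega)
          have := hinj k (by omega) j hjn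
          simp at hx
          grind
        · rw [Set.mem_Icc] at hk hl
          have := hinj l (by omega) k (by omega) hx
          omega
        · rw [Set.mem_Icc] at hk
          have := hceq k (by omega)
          have := hinj k (by omega) m hmn
          simp at hx
          grind
      · intro x hx
        have hx : x = u 0 ∨ x = u i ∨ x = u (i - 1) := by
          simp at hx
          tauto
        rcases hx with rfl | rfl | rfl
        · simp
        · rintro ((hx | ⟨l, hl, hx⟩) | hx)
          · have := hu0 i hin
            have := hinj i hin j hjn
            simp at hx
            grind
          · rw [Set.mem_Icc] at hl
            have := hinj l (by omega) i (by omega) hx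
            omega
          · have := hinj i hin m hmn
            have := hinj i hin (i - 1) (by omega)
            simp at hx
            grind
        · simp
  · have hst := hu0 i hin (by omega)
    have p₀ := hu.pathIn (Nat.zero_le i) hin
    have p₁ := (PathIn.of_adj hbi.adj).append (PathIn.of_adj hadj) (by
      rintro x ⟨rfl | hx, hx' | hx'⟩
      · exact hx'
      · exact absurd hx' hst
      · exact hx'
      · exact hx)
    have p₂ := hp'.append (hu.pathIn hij hjn).symm (by
      rintro x ⟨hx, k, hk, rfl⟩
      rw [Set.mem_Icc] at hk
      have := hbeq' k (by omega)
      have := hu0 k (by omega) (by omega)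
      simp at hx ⊢
      grind)
    refine .of_paths hst p₀ p₁ p₂ (by rw [Nat.even_iff]; omega) (by decide)
      (by rw [Nat.even_iff]; omega) ?_ ?_ ?_
    · rintro x ⟨k, hk, rfl⟩ hx
      rw [Set.mem_Icc] at hk
      have := hon k (by omega)
      simp at hx
      grind
    · rintro x ⟨k, hk, rfl⟩ (hx | ⟨l, hl, hx⟩)
      · rw [Set.mem_Icc] at hk
        have := hbeq' k (by omega)
        have := hinj k (by omega) j hjn
        simp at hx
        grind
      · rw [Set.mem_Icc] at hk hl
        have := hinj l (by omega) k (by omega) hx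
        right
        congr 1
        omega
    · intro x hx
      have hx : x = u 0 ∨ x = b ∨ x = u i := by
        simp at hx
        tauto
      rcases hx with rfl | rfl | rfl
      · simp
      · rintro (hx | ⟨l, hl, hx⟩)
        · have := hon 0 (by omega)
          have := hon j hjn
          simp at hx
          grind
        · rw [Set.mem_Icc] at hl
          exact absurd hx (hon l (by omega))
      · simp

/-- Every edge lies in a perfect matching, given as an involution. -/
lemma MatchingCovered.exists_matchesOn {G : SimpleGraph V} (h : MatchingCovered G) {u v : V}
    (huv : G.Adj u v) : ∃ σ, MatchesOn G Set.univ σ ∧ σ u = v := by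
  obtain ⟨M, ⟨hM, hs⟩, he⟩ := h.2.2 s(u, v) huv
  obtain ⟨σ, hσ, hσM⟩ := exists_matchesOn_of_isMatching hM
  rw [Subgraph.isSpanning_iff.1 hs] at hσ
  exact ⟨σ, hσ, hσM _ _ he⟩

/-- Every perfect matching has exactly one edge leaving `X`. -/
def CrossesOnce (G : SimpleGraph V) (X : Set V) : Prop :=
  ∀ σ, MatchesOn G Set.univ σ → ∃ v ∈ X, σ v ∉ X ∧ ∀ w ∈ X, σ w ∉ X → w = v

lemma IsTightCut.crossesOnce {G : SimpleGraph V} {X : Set V} (h : IsTightCut G X) :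
    CrossesOnce G X := by
  intro σ hσ
  obtain ⟨M, hM, hσM⟩ := hσ.exists_isPerfectMatching
  obtain ⟨⟨v, v'⟩, ⟨hv, hv', hvv'⟩, huniq⟩ := h.2.2 M hM
  have hv'' := (hσM _ _).1 hvv'
  refine ⟨v, hv, by simpa [hv''] using hv', fun w hw hw' => ?_⟩
  exact congrArg Prod.fst (huniq (w, σ w) ⟨hw, hw', (hσM _ _).2 rfl⟩)

lemma CrossesOnce.compl {G : SimpleGraph V} {X : Set V} (h : CrossesOnce G X) :
    CrossesOnce G Xᶜ := by
  intro σ hσ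
  obtain ⟨v, hv, hv', huniq⟩ := h σ hσ
  refine ⟨σ v, hv', by simpa [(hσ v trivial).2.2] using hv, fun w hw hw' => ?_⟩
  have := huniq (σ w) (by simpa using hw') (by simpa [(hσ w trivial).2.2] using hw)
  rw [← this, (hσ w trivial).2.2]

lemma exists_adj_leaving {G : SimpleGraph V} (h : G.Connected) {S : Set V} {u v : V} (hu : u ∈ S)
    (hv : v ∉ S) : ∃ s ∈ S, ∃ t ∉ S, G.Adj s t := by
  obtain ⟨p⟩ := h.preconnected u v
  obtain ⟨d, -, hd, hd'⟩ := p.exists_boundary_dart S hu hv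
  exact ⟨_, hd, _, hd', d.adj⟩

/-- No vertex separates the remaining ones. -/
def NoCutVertex (G : SimpleGraph V) : Prop :=
  ∀ ⦃v : V⦄ ⦃S : Set V⦄, v ∉ S → S.Nonempty → (∃ t ∉ S, t ≠ v) →
    ∃ s ∈ S, ∃ t ∉ S, t ≠ v ∧ G.Adj s t

lemma MatchingCovered.noCutVertex [Finite V] {G : SimpleGraph V} (h : MatchingCovered G) :
    NoCutVertex G := by
  rintro v S hv ⟨s₀, hs₀⟩ ⟨t₀, ht₀, htv₀⟩
  by_contra! hno
  obtain ⟨s, hs, t, ht, hst⟩ := exists_adj_leaving h.1 hs₀ hv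
  obtain rfl : t = v := by
    by_contra htv
    exact hno s hs t ht htv hst
  obtain ⟨t', ht', s', hs', hts'⟩ :=
    exists_adj_leaving h.1 (S := {w | w ∉ S ∧ w ≠ t}) (u := t₀) (v := t) ⟨ht₀, htv₀⟩ (by simp)
  obtain rfl : s' = t := by
    by_contra hst'
    simp only [Set.mem_ofPred_eq] at hs' ht'
    exact hno s' (by tauto) t' ht'.1 ht'.2 hts'.symm
  obtain ⟨σ, hσ, hσs⟩ := h.exists_matchesOn hst
  obtain ⟨τ, hτ, hτt⟩ := h.exists_matchesOn hts'
  have hT : Even {w | w ∉ S ∧ w ≠ s'}.ncard := by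
    refine MatchesOn.even_ncard (σ := σ) (hσ.restrict (Set.subset_univ _)
      fun w hw => ⟨fun hw' => ?_, fun hw' => ?_⟩)
    · exact hno _ hw' _ hw.1 hw.2 (hσ w trivial).2.1.symm
    · have h1 := (hσ w trivial).2.2
      have h2 := (hσ s trivial).2.2
      simp only [Set.mem_ofPred_eq] at hw
      grind
  have hS : Even S.ncard := by
    refine (hτ.restrict (Set.subset_univ _) fun w hw => ?_).even_ncard
    by_contra hw'
    refine hno w hw _ hw' ?_ (hτ w trivial).2.1
    have h1 := (hτ w trivial).2.2
    have h2 := (hτ t' trivial).2.2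
    simp only [Set.mem_ofPred_eq] at ht'
    grind
  have hU := hσ.even_ncard
  have e1 : Sᶜ = insert s' {w | w ∉ S ∧ w ≠ s'} := by
    ext w
    simp only [Set.mem_compl_iff, Set.mem_insert_iff, Set.mem_ofPred_eq]
    grind
  have e2 := Set.ncard_add_ncard_compl S
  rw [e1, Set.ncard_insert_of_notMem (by simp), ← Set.ncard_univ] at e2
  grind

/-- Any two vertices of `X` are joined by a path inside `X`. -/
def ConnIn (G : SimpleGraph V) (X : Set V) : Prop :=
  ∀ u ∈ X, ∀ v ∈ X, ∃ n, PathIn G X n u v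

lemma CrossesOnce.odd_ncard [Finite V] {G : SimpleGraph V} {X : Set V} {σ : V → V} {x : V}
    (h : CrossesOnce G X) (hσ : MatchesOn G Set.univ σ) (hx : x ∈ X) (hσx : σ x ∉ X) :
    Odd X.ncard := by
  obtain ⟨v, -, -, huniq⟩ := h σ hσ
  obtain rfl := huniq x hx hσx
  have : Even (X \ {x}).ncard := by
    refine MatchesOn.even_ncard (σ := σ) (hσ.restrict (Set.subset_univ _) fun w hw => ⟨?_, ?_⟩)
    · by_contra hw'
      exact hw.2 (huniq w hw.1 hw')
    · rintro (hw' : σ w = x)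
      exact hσx (by rw [← hw', (hσ w trivial).2.2]; exact hw.1)
  rw [← Set.ncard_sdiff_singleton_add_one hx]
  exact this.add_one

lemma CrossesOnce.even_ncard_diff [Finite V] {G : SimpleGraph V} {X A : Set V}
    (hmc : MatchingCovered G) (h : CrossesOnce G X) (hAX : A ⊆ X) (hA : A.Nonempty)
    (hA' : (X \ A).Nonempty) (hno : ∀ s ∈ A, ∀ t ∈ X \ A, ¬ G.Adj s t) :
    Odd X.ncard ∧ Even (X \ A).ncard := by
  obtain ⟨a, ha⟩ := hA
  obtain ⟨x, hx, y, hy, hxy⟩ := exists_adj_leaving hmc.1 ha hA'.some_mem.2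
  have hyX : y ∉ X := fun hyX => hno x hx y ⟨hyX, hy⟩ hxy
  obtain ⟨σ, hσ, hσx⟩ := hmc.exists_matchesOn hxy
  refine ⟨h.odd_ncard hσ (hAX hx) (hσx ▸ hyX), MatchesOn.even_ncard (σ := σ)
    (hσ.restrict (Set.subset_univ _) fun w hw => ⟨?_, fun hw' => ?_⟩)⟩
  · obtain ⟨v, -, -, huniq⟩ := h σ hσ
    by_contra hw'
    have h1 := huniq x (hAX hx) (hσx ▸ hyX)
    have h2 := huniq w hw.1 hw'
    rw [h2, ← h1] at hw
    exact hw.2 hx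
  · exact hno _ hw' _ hw (hσ w trivial).2.1.symm

lemma CrossesOnce.connIn [Finite V] {G : SimpleGraph V} {X : Set V} (hmc : MatchingCovered G)
    (h : CrossesOnce G X) : ConnIn G X := by
  intro u hu v hv
  by_contra huv
  set A : Set V := {w | ∃ n, PathIn G X n u w} with hA
  have hAX : A ⊆ X := fun w ⟨n, hw⟩ => hw.right_mem
  have hno : ∀ s ∈ A, ∀ t ∈ X \ A, ¬ G.Adj s t := by
    rintro s ⟨n, hs⟩ t ⟨ht, htA⟩ hst
    exact htA (hs.trans (PathIn.of_adj_mem hst hs.right_mem ht))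
  have hAne : A.Nonempty := ⟨u, 0, PathIn.refl hu⟩
  have hA' : (X \ A).Nonempty := ⟨v, hv, huv⟩
  have hd : X \ (X \ A) = A := by
    rw [Set.sdiff_sdiff_right_self, Set.inter_eq_right.2 hAX]
  obtain ⟨h1, h2⟩ := h.even_ncard_diff hmc hAX hAne hA' hno
  obtain ⟨-, h3⟩ := h.even_ncard_diff hmc Set.sdiff_subset hA' (by rwa [hd])
    fun s hs t ht hst => hno t (hd ▸ ht) s hs hst.symm
  rw [hd] at h3
  rw [← Set.ncard_sdiff_add_ncard_of_subset hAX] at h1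
  grind

/-- All paths from `u` to `v` inside `K` have even length. -/
def EvenConn (G : SimpleGraph V) (K : Set V) (u v : V) : Prop :=
  ∀ n, PathIn G K n u v → Even n

lemma EvenConn.refl {G : SimpleGraph V} {K : Set V} (u : V) : EvenConn G K u u := by
  rintro n ⟨p, hp, rfl, -⟩
  simp [Walk.length_eq_zero_iff.2 (Walk.isPath_iff_nil.1 hp)]

lemma EvenConn.symm {G : SimpleGraph V} {K : Set V} {u v : V} (h : EvenConn G K u v) :
    EvenConn G K v u :=
  fun n hn => h n hn.symm

lemma EvenConn.trans {G : SimpleGraph V} {K : Set V} {u v w : V} (hK : ConnIn G K) (hv : v ∈ K)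
    (huv : EvenConn G K u v) (hvw : EvenConn G K v w) : EvenConn G K u w := by
  classical
  rintro n ⟨p, hp, rfl, hpK⟩
  obtain ⟨-, r, -, -, hrK⟩ := hK v hv u (hpK _ p.start_mem_support)
  obtain ⟨c, hc, q, hq, hqr, hqp⟩ :=
    exists_path_to_set (S := {x | x ∈ p.support}) r p.start_mem_support
  have hc : c ∈ p.support := hc
  have h1 := huv _ ⟨(p.takeUntil c hc).append q.reverse,
    isPath_append_of_inter (hp.takeUntil hc) hq.reverse fun x hx hx' =>
      hqp x (by simpa using hx') (p.support_takeUntil_subset_support hc hx), rfl, fun x hx => by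
      rw [Walk.mem_support_append_iff, Walk.support_reverse, List.mem_reverse] at hx
      exact hx.elim (fun hx => hpK _ (p.support_takeUntil_subset_support hc hx))
        fun hx => hrK _ (hqr _ hx)⟩
  have h2 := hvw _ ⟨q.append (p.dropUntil c hc),
    isPath_append_of_inter hq (hp.dropUntil hc) fun x hx hx' =>
      hqp x hx (p.support_dropUntil_subset_support hc hx'), rfl, fun x hx => by
      rw [Walk.mem_support_append_iff] at hx
      exact hx.elim (fun hx => hrK _ (hqr _ hx))
        fun hx => hpK _ (p.support_dropUntil_subset_support hc hx)⟩
  have h3 := congrArg Walk.length (p.take_spec hc)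
  simp only [Walk.length_append, Walk.length_reverse] at h1 h2 h3
  grind

lemma exists_matchesOn_interior {G : SimpleGraph V} {u v : V} (p : G.Walk u v) (hp : p.IsPath)
    (h : Odd p.length) : ∃ σ, MatchesOn G {w | w ∈ p.support ∧ w ≠ u ∧ w ≠ v} σ := by
  cases p with
  | nil => simp at h
  | cons hab p =>
    rw [Walk.cons_isPath_iff] at hp
    obtain ⟨σ, hσ⟩ := (exists_matchesOn_path p.reverse hp.1.reverse).1
      (by simpa [Nat.odd_add_one] using h)
    refine ⟨σ, ?_⟩
    convert hσ using 2 with w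
    simp only [Walk.support_cons, List.mem_cons, Walk.support_reverse, List.mem_reverse]
    grind

/-- Odd paths on both shores between the ends of two edges of the cut contradict
`CrossesOnce`. -/
lemma CrossesOnce.not_odd_odd {G : SimpleGraph V} {X : Set V} (hce : CycleExtendable G)
    (h : CrossesOnce G X) {x₁ x₂ y₁ y₂ : V} (h₁ : G.Adj x₁ y₁) (h₂ : G.Adj x₂ y₂) {m n : ℕ}
    (hp : PathIn G X m x₁ x₂) (hq : PathIn G Xᶜ n y₁ y₂) (hm : Odd m) (hn : Odd n) : False := by
  obtain ⟨p, hp, rfl, hpX⟩ := hp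
  obtain ⟨q, hq, rfl, hqX⟩ := hq
  have hx₁₂ : x₁ ≠ x₂ := by
    rintro rfl
    simp [Walk.length_eq_zero_iff.2 (Walk.isPath_iff_nil.1 hp)] at hm
  have hy₁₂ : y₁ ≠ y₂ := by
    rintro rfl
    simp [Walk.length_eq_zero_iff.2 (Walk.isPath_iff_nil.1 hq)] at hn
  have hx₁ := hpX _ p.start_mem_support
  have hx₂ := hpX _ p.end_mem_support
  have hq' : (Walk.cons h₁ (q.append (.cons h₂.symm .nil))).IsPath := by
    rw [Walk.cons_isPath_iff]
    constructor
    · refine isPath_append_of_inter hq (by simp [h₂.ne']) fun x hx hx' => ?_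
      simp only [Walk.support_cons, Walk.support_nil, List.mem_cons, List.not_mem_nil,
        or_false] at hx'
      rcases hx' with rfl | rfl
      · rfl
      · exact absurd hx₂ (hqX _ hx)
    · simp only [Walk.mem_support_append_iff, Walk.support_cons, Walk.support_nil, List.mem_cons,
        List.not_mem_nil, or_false]
      rintro (hx | rfl | hx)
      · exact hqX _ hx hx₁
      · exact hqX _ q.end_mem_support hx₁
      · exact hx₁₂ hx
  have hq's : ∀ w, w ∈ (Walk.cons h₁ (q.append (.cons h₂.symm .nil))).support ↔
      w = x₁ ∨ w ∈ q.support ∨ w = x₂ := by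
    intro w
    have := q.end_mem_support
    simp only [Walk.support_cons, List.mem_cons, Walk.mem_support_append_iff, Walk.support_nil,
      List.not_mem_nil, or_false]
    grind
  obtain ⟨c, hc, hcl, hcs⟩ := exists_isCycle_of_paths _ p hq' hp (fun w hw hw' => by
    rw [hq's] at hw
    have := hpX w hw'
    rcases hw with hw | hw | hw
    · exact .inl hw
    · exact absurd this (hqX w hw)
    · exact .inr hw) (by simp) hx₁₂
  obtain ⟨σ, hσ⟩ := (hce c hc (by
    rw [hcl]; simp only [Walk.length_cons, Walk.length_append, Walk.length_nil]; grind)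
    ).exists_matchesOn
  obtain ⟨τ₁, hτ₁⟩ := exists_matchesOn_interior p hp hm
  obtain ⟨τ₂, hτ₂⟩ := exists_matchesOn_interior q hq hn
  obtain ⟨π₁, hπ₁, hπ₁'⟩ := MatchesOn.pair h₁
  obtain ⟨π₂, hπ₂, hπ₂'⟩ := MatchesOn.pair h₂
  simp only [hq's] at hcs
  have hps := p.start_mem_support
  have hpe := p.end_mem_support
  have hqs := q.start_mem_support
  have hqe := q.end_mem_support
  obtain ⟨ρ₁, hρ₁, -, -⟩ := hσ.union hτ₁ (by
    simp only [Set.mem_ofPred_eq, hcs]; tauto)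
  obtain ⟨ρ₂, hρ₂, -, -⟩ := hρ₁.union hτ₂ (by
    simp only [Set.mem_union, Set.mem_ofPred_eq, hcs]
    have := fun w hw hw' => hqX w hw (hpX w hw')
    grind)
  obtain ⟨ρ₃, hρ₃, hρ₃', hρ₃''⟩ := hπ₁.union hπ₂ (by
    simp only [Set.mem_insert_iff, Set.mem_singleton_iff]
    have := fun w hw hw' => hqX w hw (hpX w hw')
    grind)
  obtain ⟨ρ, hρ, -, hρ'⟩ := hρ₂.union hρ₃ (by
    simp only [Set.mem_union, Set.mem_ofPred_eq, hcs, Set.mem_insert_iff, Set.mem_singleton_iff]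
    have := fun w hw hw' => hqX w hw (hpX w hw')
    grind)
  have hU : ∀ s : Set V, (∀ w, w ∈ s) → MatchesOn G s ρ → MatchesOn G Set.univ ρ :=
    fun s hs h => (Set.eq_univ_iff_forall.2 hs) ▸ h
  obtain ⟨v, -, -, huniq⟩ := h ρ (hU _ (fun w => by
    simp only [Set.mem_union, Set.mem_ofPred_eq, hcs, Set.mem_insert_iff, Set.mem_singleton_iff]
    tauto) hρ)
  have e₁ : ρ x₁ = y₁ := by rw [hρ' _ (by simp), hρ₃' _ (by simp), hπ₁']
  have e₂ : ρ x₂ = y₂ := by rw [hρ' _ (by simp), hρ₃'' _ (by simp), hπ₂']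
  exact hx₁₂ ((huniq x₁ hx₁ (e₁ ▸ hqX _ hqs)).trans (huniq x₂ hx₂ (e₂ ▸ hqX _ hqe)).symm)

/-- If two equivalence relations cover all pairs, then one of them is total. -/
lemma total_or_total {α : Type*} {r s : α → α → Prop} (hr : Equivalence r) (hs : Equivalence s)
    (h : ∀ a b, r a b ∨ s a b) : (∀ a b, r a b) ∨ ∀ a b, s a b := by
  by_contra! hno
  obtain ⟨⟨a, b, hab⟩, c, d, hcd⟩ := hno
  have hsab := (h a b).resolve_left hab
  have hrcd := (h c d).resolve_right hcd
  rcases h a c with h1 | h1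
  · have h2 : ¬ r b c := fun h2 => hab (hr.trans h1 (hr.symm h2))
    have h3 : ¬ r b d := fun h3 => h2 (hr.trans h3 (hr.symm hrcd))
    exact hcd (hs.trans (hs.symm ((h b c).resolve_left h2)) ((h b d).resolve_left h3))
  · have h2 : ¬ s a d := fun h2 => hcd (hs.trans (hs.symm h1) h2)
    have h3 : ¬ s b d := fun h3 => h2 (hs.trans hsab h3)
    have h4 := (h a d).resolve_right h2
    have h5 := (h b d).resolve_right h3
    exact hab (hr.trans h4 (hr.symm h5))

/-- The vertices of `K` with a neighbour outside `K` are pairwise joined by even paths only. -/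
def EvenBoundary (G : SimpleGraph V) (K : Set V) : Prop :=
  ∀ x₁ ∈ K, ∀ y₁ ∉ K, G.Adj x₁ y₁ → ∀ x₂ ∈ K, ∀ y₂ ∉ K, G.Adj x₂ y₂ → EvenConn G K x₁ x₂

lemma CrossesOnce.evenBoundary [Finite V] {G : SimpleGraph V} {X : Set V}
    (hmc : MatchingCovered G) (hce : CycleExtendable G) (h : CrossesOnce G X) :
    EvenBoundary G X ∨ EvenBoundary G Xᶜ := by
  let E := {e : V × V // e.1 ∈ X ∧ e.2 ∉ X ∧ G.Adj e.1 e.2}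
  have hX := h.connIn hmc
  have hX' := h.compl.connIn hmc
  have h1 : Equivalence fun e f : E => EvenConn G X e.1.1 f.1.1 :=
    ⟨fun _ => .refl _, .symm, fun {_ e _} => .trans hX e.2.1⟩
  have h2 : Equivalence fun e f : E => EvenConn G Xᶜ e.1.2 f.1.2 :=
    ⟨fun _ => .refl _, .symm, fun {_ e _} => .trans hX' e.2.2.1⟩
  refine (total_or_total h1 h2 fun e f => ?_).imp (fun hE => ?_) fun hE => ?_
  · by_contra hno
    simp only [EvenConn, not_or, not_forall, Nat.not_even_iff_odd] at hno
    obtain ⟨⟨m, hm, hm'⟩, n, hn, hn'⟩ := hno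
    exact h.not_odd_odd hce e.2.2.2 f.2.2.2 hm hn hm' hn'
  · exact fun x₁ hx₁ y₁ hy₁ h₁ x₂ hx₂ y₂ hy₂ h₂ =>
      hE ⟨(x₁, y₁), hx₁, hy₁, h₁⟩ ⟨(x₂, y₂), hx₂, hy₂, h₂⟩
  · exact fun x₁ hx₁ y₁ hy₁ h₁ x₂ hx₂ y₂ hy₂ h₂ =>
      hE ⟨(y₁, x₁), not_not.1 hy₁, hx₁, h₁.symm⟩ ⟨(y₂, x₂), not_not.1 hy₂, hx₂, h₂.symm⟩

/-- The vertices reachable from `v` inside `D`. -/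
def compIn (G : SimpleGraph V) (D : Set V) (v : V) : Set V :=
  {w | ∃ n, PathIn G D n v w}

section compIn

variable {G : SimpleGraph V} {D : Set V} {v w : V}

lemma compIn_subset : compIn G D v ⊆ D := fun _ ⟨_, h⟩ => h.right_mem

lemma mem_compIn_self (h : v ∈ D) : v ∈ compIn G D v := ⟨0, .refl h⟩

lemma mem_compIn_of_adj {s t : V} (hs : s ∈ compIn G D v) (ht : t ∈ D) (h : G.Adj s t) :
    t ∈ compIn G D v := by
  obtain ⟨n, hs⟩ := hs
  exact hs.trans (.of_adj_mem h hs.right_mem ht)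

lemma compIn_eq (h : w ∈ compIn G D v) : compIn G D w = compIn G D v := by
  obtain ⟨n, h⟩ := h
  ext x
  exact ⟨fun ⟨k, hk⟩ => h.trans hk, fun ⟨k, hk⟩ => h.symm.trans hk⟩

lemma connIn_compIn : ConnIn G (compIn G D v) := by
  classical
  rintro a ⟨m, ha⟩ b ⟨n, hb⟩
  obtain ⟨k, p, hp, -, hpD⟩ := ha.symm.trans hb
  exact ⟨_, p, hp, rfl, fun w hw => ha.trans ⟨p.takeUntil w hw, hp.takeUntil hw, rfl,
    fun x hx => hpD x (p.support_takeUntil_subset_support hw hx)⟩⟩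

end compIn

/-- If `K` is connected and its boundary vertices are pairwise joined by even paths only, then
`K` induces a bipartite graph with all boundary vertices in the same class. -/
lemma exists_independent_of_evenBoundary [Finite V] {G : SimpleGraph V} (hG : G.Connected)
    (hnc : NoCutVertex G) (n : ℕ) : ∀ K : Set V, K.ncard = n → Kᶜ.Nonempty → ConnIn G K →
    EvenBoundary G K → ∃ A ⊆ K, (∀ u ∈ A, ∀ v, G.Adj u v → v ∈ K \ A) ∧
      ∀ u ∈ K \ A, ∀ v ∈ K \ A, ¬ G.Adj u v := by
  classical
  induction n using Nat.strong_induction_on with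
  | _ n ih =>
    rintro K hn ⟨z, hz⟩ hK hE
    rcases K.eq_empty_or_nonempty with rfl | ⟨b₁, hb₁⟩
    · exact ⟨∅, by simp⟩
    obtain ⟨b, hb, y, hy, hby⟩ := exists_adj_leaving hG hb₁ hz
    set S : Set V := {v | v ∈ K ∧ EvenConn G K b v} with hS
    have hSS : ∀ s ∈ S, ∀ t ∈ S, EvenConn G K s t :=
      fun s hs t ht => hs.2.symm.trans hK hb ht.2
    have hbd : ∀ u ∈ K, ∀ v ∉ K, G.Adj u v → u ∈ S :=
      fun u hu v hv huv => ⟨hu, hE b hb y hy hby u hu v hv huv⟩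
    have hsub : ∀ v, compIn G (K \ S) v ⊆ K \ S := fun v => compIn_subset
    have hout : ∀ v, ∀ s ∈ compIn G (K \ S) v, ∀ t ∉ compIn G (K \ S) v, G.Adj s t → t ∈ S := by
      intro v s hs t ht hst
      by_contra htS
      have hs' := hsub v hs
      by_cases htK : t ∈ K
      · exact ht (mem_compIn_of_adj hs ⟨htK, htS⟩ hst)
      · exact hs'.2 (hbd s hs'.1 t htK hst)
    have hEC : ∀ v, EvenBoundary G (compIn G (K \ S) v) := by
      intro v
      set C := compIn G (K \ S) v with hC
      have key : ∀ k ∈ C, ∀ s ∉ C, G.Adj k s → ∀ k' ∈ C, ∀ s' ∉ C, G.Adj k' s' → s ≠ s' →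
          EvenConn G C k k' := by
        intro k hk s hs hks k' hk' s' hs' hks' hss m hm
        have hsS := hout v k hk s hs hks
        have hsS' := hout v k' hk' s' hs' hks'
        have h1 := (PathIn.of_adj hks.symm).append hm (by
          rintro x ⟨rfl | hx, hx'⟩
          · exact absurd hx' hs
          · exact hx)
        have h2 := h1.append (PathIn.of_adj hks') (by
          rintro x ⟨hx, hx' | hx'⟩
          · exact hx'
          · obtain rfl : x = s' := hx'
            rcases hx with (hx | hx) | hx
            · exact absurd hx.symm hss
            · exact absurd (hx ▸ hk) hs'
            · exact absurd hx hs')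
        have h3 := hSS s hsS s' hsS' _ (h2.mono (by
          have : ∀ x ∈ C, x ∈ K := fun x hx => (hsub v hx).1
          rintro x ((((rfl | rfl) | hx) | (rfl | rfl)))
          · exact hsS.1
          · exact this _ hk
          · exact this _ hx
          · exact this _ hk'
          · exact hsS'.1))
        grind
      intro k hk s hs hks k' hk' s' hs' hks'
      by_cases hss : s = s'
      · subst hss
        have hsS := hout v k hk s hs hks
        obtain ⟨k'', hk'', s'', hs'', hss'', h''⟩ := hnc hs ⟨k, hk⟩
          ⟨z, fun hzC => hz (hsub v hzC).1, fun h => hz (h ▸ hsS.1)⟩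
        exact (key k hk s hs hks k'' hk'' s'' hs'' h'' hss''.symm).trans connIn_compIn hk''
          (key k'' hk'' s'' hs'' h'' k' hk' s hs' hks' hss'')
      · exact key k hk s hs hks k' hk' s' hs' hks' hss
    have hlt : ∀ v, (compIn G (K \ S) v).ncard < n := by
      intro v
      rw [← hn]
      refine Set.ncard_lt_ncard ⟨fun x hx => (hsub v hx).1, fun h => ?_⟩
      exact (hsub v (h hb)).2 ⟨hb, .refl b⟩
    have hex := fun v => ih _ (hlt v) (compIn G (K \ S) v) rfl
      ⟨z, fun hzC => hz (hsub v hzC).1⟩ connIn_compIn (hEC v)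
    have hf : ∃ f : Set V → Set V, ∀ v, f (compIn G (K \ S) v) ⊆ compIn G (K \ S) v ∧
        (∀ u ∈ f (compIn G (K \ S) v), ∀ w, G.Adj u w →
          w ∈ compIn G (K \ S) v \ f (compIn G (K \ S) v)) ∧
        ∀ u ∈ compIn G (K \ S) v \ f (compIn G (K \ S) v),
          ∀ w ∈ compIn G (K \ S) v \ f (compIn G (K \ S) v), ¬ G.Adj u w := by
      have : ∀ C : Set V, ∃ A, (∃ v, C = compIn G (K \ S) v) → A ⊆ C ∧
          (∀ u ∈ A, ∀ w, G.Adj u w → w ∈ C \ A) ∧ ∀ u ∈ C \ A, ∀ w ∈ C \ A, ¬ G.Adj u w := by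
        intro C
        by_cases hC : ∃ v, C = compIn G (K \ S) v
        · obtain ⟨v, rfl⟩ := hC
          obtain ⟨A, hA⟩ := hex v
          exact ⟨A, fun _ => hA⟩
        · exact ⟨∅, fun h => absurd h hC⟩
      choose f hf using this
      exact ⟨f, fun v => hf _ ⟨v, rfl⟩⟩
    obtain ⟨f, hf⟩ := hf
    have hcomp : ∀ u ∈ K \ S, ∀ w ∈ K \ S, G.Adj u w →
        compIn G (K \ S) w = compIn G (K \ S) u :=
      fun u hu w hw huw => compIn_eq (mem_compIn_of_adj (mem_compIn_self hu) hw huw)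
    refine ⟨{w | w ∈ K \ S ∧ w ∉ f (compIn G (K \ S) w)}, fun w hw => hw.1.1, ?_, ?_⟩
    · rintro u ⟨hu, huf⟩ w huw
      have hwK : w ∈ K := by
        by_contra hwK
        exact hu.2 (hbd u hu.1 w hwK huw)
      refine ⟨hwK, fun ⟨hw, hwf⟩ => ?_⟩
      have hc := hcomp u hu w hw huw
      exact (hf u).2.2 u ⟨mem_compIn_self hu, huf⟩ w
        ⟨hc ▸ mem_compIn_self hw, hc ▸ hwf⟩ huw
    · have hcross : ∀ u ∈ K \ S, u ∈ f (compIn G (K \ S) u) → ∀ w ∈ S, ¬ G.Adj u w := by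
        intro u hu huf w hw huw
        exact (hsub u ((hf u).2.1 u huf w huw).1).2 hw
      rintro u ⟨hu, huA⟩ w ⟨hw, hwA⟩ huw
      simp only [Set.mem_ofPred_eq, not_and, not_not] at huA hwA
      by_cases huS : u ∈ S <;> by_cases hwS : w ∈ S
      · exact absurd (hSS u huS w hwS 1 (.of_adj_mem huw hu hw)) (by simp)
      · exact hcross w ⟨hw, hwS⟩ (hwA ⟨hw, hwS⟩) u huS huw.symm
      · exact hcross u ⟨hu, huS⟩ (huA ⟨hu, huS⟩) w hwS huw
      · have hc := hcomp u ⟨hu, huS⟩ w ⟨hw, hwS⟩ huw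
        exact ((hf u).2.1 u (huA ⟨hu, huS⟩) w huw).2 (hc ▸ hwA ⟨hw, hwS⟩)

lemma exists_adj_ne_ne [Finite V] {G : SimpleGraph V} {v : V} (h : 3 ≤ (G.neighborSet v).ncard)
    (x y : V) : ∃ w, G.Adj v w ∧ w ≠ x ∧ w ≠ y := by
  by_contra! hno
  have h1 : G.neighborSet v ⊆ {x, y} := fun w hw => by
    by_cases hwx : w = x
    · exact .inl hwx
    · exact .inr (hno w hw hwx)
  have h2 := (Set.ncard_le_ncard h1).trans (Set.ncard_insert_le x {y})
  rw [Set.ncard_singleton] at h2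
  omega

lemma hasEvenTheta_of_card_neighbors_le [Finite V] {G : SimpleGraph V}
    (hdeg : ∀ v, 3 ≤ (G.neighborSet v).ncard) (n : ℕ) : ∀ A : Set V, A.ncard = n → A.Nonempty →
    (∀ a ∈ A, ∀ b ∈ A, ¬ G.Adj a b) → {w | ∃ a ∈ A, G.Adj a w}.ncard ≤ n + 1 →
    HasEvenTheta G := by
  induction n using Nat.strong_induction_on with
  | _ n ih =>
    rintro A hn ⟨a₀, ha₀⟩ hind hN
    set B : Set V := {w | ∃ a ∈ A, G.Adj a w} with hB
    by_cases hx : ∀ b ∈ B, ∀ x, ∃ a ∈ A, G.Adj b a ∧ a ≠ x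
    · refine hasEvenTheta_of_degrees (A := A) (B := B)
        (fun w hw ⟨a, ha, haw⟩ => hind a ha w hw haw) ⟨a₀, ha₀⟩ (fun a ha x y => ?_) hx
      obtain ⟨w, hw, hwx, hwy⟩ := exists_adj_ne_ne (hdeg a) x y
      exact ⟨w, ⟨a, ha, hw⟩, hw, hwx, hwy⟩
    · push Not at hx
      obtain ⟨b, ⟨a, ha, hab⟩, x, hx⟩ := hx
      obtain rfl := hx a ha hab.symm
      have h3 : 3 ≤ B.ncard :=
        (hdeg a).trans (Set.ncard_le_ncard fun w hw => ⟨a, ha, hw⟩)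
      have hc := Set.ncard_sdiff_singleton_add_one ha
      refine ih (A \ {a}).ncard (by omega) _ rfl ?_ (fun u hu v hv => hind u hu.1 v hv.1) ?_
      · rw [← Set.ncard_pos]
        omega
      · have h1 : {w | ∃ u ∈ A \ {a}, G.Adj u w} ⊆ B \ {b} := by
          rintro w ⟨u, hu, huw⟩
          refine ⟨⟨u, hu.1, huw⟩, ?_⟩
          rintro rfl
          exact hu.2 (hx u hu.1 huw.symm)
        have h2 := Set.ncard_le_ncard h1
        have h3 := Set.ncard_sdiff_singleton_add_one (s := B) (a := b) ⟨a, ha, hab⟩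
        omega

lemma CrossesOnce.not_evenBoundary [Finite V] {G : SimpleGraph V} {X : Set V}
    (hmc : MatchingCovered G) (hdeg : ∀ v, 3 ≤ (G.neighborSet v).ncard) (hθ : ¬ HasEvenTheta G)
    (h : CrossesOnce G X) (hX : 2 ≤ X.ncard) (hX' : Xᶜ.Nonempty) : ¬ EvenBoundary G X := by
  intro hE
  obtain ⟨A, hAX, hA, hB⟩ := exists_independent_of_evenBoundary hmc.1 hmc.noCutVertex _ X rfl hX'
    (h.connIn hmc) hE
  obtain ⟨x₀, hx₀⟩ := hX'
  obtain ⟨y₀, hy₀, -, -⟩ := exists_adj_ne_ne (hdeg x₀) x₀ x₀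
  obtain ⟨σ, hσ, -⟩ := hmc.exists_matchesOn hy₀
  obtain ⟨x, -, -, huniq⟩ := h σ hσ
  have h1 : ((X \ A) \ {x}).ncard ≤ A.ncard := by
    refine Set.ncard_le_ncard_of_injOn σ (fun b hb => ?_) fun b _ b' _ hbb => ?_
    · have hbX : σ b ∈ X := by
        by_contra hbX
        exact hb.2 (huniq b hb.1.1 hbX)
      by_contra hbA
      exact hB b hb.1 _ ⟨hbX, hbA⟩ (hσ b trivial).2.1
    · rw [← (hσ b trivial).2.2, hbb, (hσ b' trivial).2.2]
  have h2 := Set.ncard_le_ncard_sdiff_add_ncard (X \ A) {x}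
  rw [Set.ncard_singleton] at h2
  have h3 := Set.ncard_sdiff_add_ncard_of_subset hAX
  refine hθ (hasEvenTheta_of_card_neighbors_le hdeg _ A rfl ?_
    (fun a ha b hb hab => (hA a ha b hab).2 hb) ?_)
  · rw [← Set.ncard_pos]
    omega
  · refine (Set.ncard_le_ncard ?_).trans (h2.trans (Nat.add_le_add_right h1 1))
    rintro w ⟨a, ha, haw⟩
    exact hA a ha w haw

lemma hasEvenTheta_of_colorable [Finite V] [Nonempty V] {G : SimpleGraph V}
    (hdeg : ∀ v, 3 ≤ (G.neighborSet v).ncard) (h : G.Colorable 2) : HasEvenTheta G := by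
  obtain ⟨C⟩ := h
  obtain ⟨v⟩ := ‹Nonempty V›
  refine hasEvenTheta_of_degrees (A := {w | C w = C v}) (B := {w | C w ≠ C v})
    (fun a ha hb => hb ha) ⟨v, rfl⟩ (fun a ha x y => ?_) fun b hb x => ?_
  · obtain ⟨w, hw, hwx, hwy⟩ := exists_adj_ne_ne (hdeg a) x y
    refine ⟨w, fun hwv => C.valid hw ?_, hw, hwx, hwy⟩
    rw [hwv]
    exact ha
  · obtain ⟨w, hw, hwx, -⟩ := exists_adj_ne_ne (hdeg b) x x
    have h1 : C b ≠ C w := C.valid hw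
    have h2 : C b ≠ C v := hb
    refine ⟨w, ?_, hw, hwx⟩
    rw [Set.mem_ofPred_eq]
    omega

/-- Every simple planar cycle-extendable graph with minimum degree at
least three is a brick. -/
theorem planar_cycleExtendable_minDegree_three_isBrick [Fintype V] (G : SimpleGraph V)
    (hmc : MatchingCovered G) (hplanar : IsPlanar G) (hce : CycleExtendable G)
    (hdeg : ∀ v : V, 3 ≤ (G.neighborSet v).ncard) :
    IsBrick G := by
  have hθ := not_hasEvenTheta hplanar hce
  have := hmc.1.nonempty
  refine ⟨hmc, fun hcol => hθ (hasEvenTheta_of_colorable hdeg hcol), ?_⟩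
  rintro ⟨X, hX, h2, h2'⟩
  have hcross := hX.crossesOnce
  rcases hcross.evenBoundary hmc hce with hE | hE
  · exact hcross.not_evenBoundary hmc hdeg hθ h2 (Set.nonempty_compl.2 hX.2.1) hE
  · exact hcross.compl.not_evenBoundary hmc hdeg hθ h2' (by simpa using hX.1) hE
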